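/- Let δ be an IP-feasible function such that for each target τ ∈ {1,…,T} there is a pair (s^τ, r^τ) with δ(τ, s^τ, r^τ) = 1, and suppose the cost function C satisfies C(τ, s^τ, r^τ) = min over all (s,r) of C(τ, s, r) for each τ ∈ {1,…,T}, and C(0, s, r) = 0 for all (s,r). Then δ admits no descent direction: for every function d on local hypotheses such that δ + θ·d is LP-feasible for some θ > 0, one has Σ_{(τ,s,r)} C(τ,s,r)·d(τ,s,r) ≥ 0. -/

import Mathlib

open Finset

/-- The type of local hypotheses `(τ, s, r)`: a target index `τ ∈ {0,1,…,T}` (with `0` the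
dummy target), a model index vector `s` with `s n ∈ {1,…,S n}`, and a measurement index
vector `r` with `r n ∈ {0,1,…,R n}` (with `0` the dummy measurement). -/
abbrev Hyp (T N : ℕ) (S R : Fin N → ℕ) : Type :=
  Fin (T + 1) × ((m : Fin N) → Fin (S m)) × ((m : Fin N) → Fin (R m + 1))

/-- LP-feasibility: values in `[0,1]`, each (real) target's hypotheses have total
probability `1`, and each (real) measurement in each scan has total probability `1`. -/
def LPFeasible (T N : ℕ) (S R : Fin N → ℕ) (P : Hyp T N S R → ℝ) : Prop :=
  (∀ h, 0 ≤ P h ∧ P h ≤ 1) ∧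
  (∀ τ : Fin T, ∑ s : (m : Fin N) → Fin (S m), ∑ r : (m : Fin N) → Fin (R m + 1),
      P (τ.succ, s, r) = 1) ∧
  (∀ n : Fin N, ∀ j : Fin (R n),
      ∑ τ : Fin (T + 1), ∑ s : (m : Fin N) → Fin (S m),
        ∑ r ∈ Finset.univ.filter fun r : (m : Fin N) → Fin (R m + 1) => r n = j.succ,
          P (τ, s, r) = 1)

/-- IP-feasibility: LP-feasible and taking only the values `0` and `1`. -/
def IPFeasible (T N : ℕ) (S R : Fin N → ℕ) (P : Hyp T N S R → ℝ) : Prop :=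
  LPFeasible T N S R P ∧ ∀ h, P h = 0 ∨ P h = 1

/-- A cost minimized at `i₀` has nonnegative pairing with any direction of zero total mass
that is nonnegative away from `i₀`. -/
theorem sum_mul_nonneg_of_sum_eq_zero {ι : Type*} [Fintype ι] {c d : ι → ℝ} {i₀ : ι}
    (hc : ∀ i, c i₀ ≤ c i) (hd : ∀ i, i ≠ i₀ → 0 ≤ d i) (hsum : ∑ i, d i = 0) :
    0 ≤ ∑ i, c i * d i := by
  have key : ∑ i, c i * d i = ∑ i, (c i - c i₀) * d i := by
    simp [sub_mul, Finset.sum_sub_distrib, ← Finset.mul_sum, hsum]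
  rw [key]
  refine Finset.sum_nonneg fun i _ => ?_
  by_cases h : i = i₀
  · simp [h]
  · exact mul_nonneg (sub_nonneg.mpr (hc i)) (hd i h)

/-- A nonnegative family of total mass `1` that takes the value `1` vanishes elsewhere. -/
theorem eq_zero_of_sum_eq_one {ι : Type*} [Fintype ι] {p : ι → ℝ} {i₀ : ι}
    (hp : ∀ i, 0 ≤ p i) (hsum : ∑ i, p i = 1) (hone : p i₀ = 1) {i : ι} (hi : i ≠ i₀) :
    p i = 0 := by
  classical
  have hrest : ∑ j ∈ Finset.univ.erase i₀, p j = 0 := by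
    have := Finset.add_sum_erase Finset.univ p (Finset.mem_univ i₀)
    linarith
  exact (Finset.sum_eq_zero_iff_of_nonneg fun j _ => hp j).mp hrest i (by simp [hi])

/-- A minimum-cost feasible 0-1 assignment `δ` (with zero cost on dummy-target hypotheses)
admits no descent direction in the LP relaxation: for every direction `d` such that
`δ + θ·d` is LP-feasible for some `θ > 0`, the directional change of the objective is
nonnegative. -/
theorem no_descent_direction (T N : ℕ) (S R : Fin N → ℕ)
    (hT : 0 < T) (hN : 0 < N) (hS : ∀ n, 0 < S n)
    (C : Hyp T N S R → ℝ) (δ : Hyp T N S R → ℝ)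
    (hδ : IPFeasible T N S R δ)
    (sτ : Fin T → (m : Fin N) → Fin (S m))
    (rτ : Fin T → (m : Fin N) → Fin (R m + 1))
    (hone : ∀ τ : Fin T, δ (τ.succ, sτ τ, rτ τ) = 1)
    (hmin : ∀ τ : Fin T, ∀ (s : (m : Fin N) → Fin (S m)) (r : (m : Fin N) → Fin (R m + 1)),
      C (τ.succ, sτ τ, rτ τ) ≤ C (τ.succ, s, r))
    (hzero : ∀ (s : (m : Fin N) → Fin (S m)) (r : (m : Fin N) → Fin (R m + 1)),
      C (0, s, r) = 0) :
    ∀ d : Hyp T N S R → ℝ,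
      (∃ θ : ℝ, 0 < θ ∧ LPFeasible T N S R (fun h => δ h + θ * d h)) →
      0 ≤ ∑ h, C h * d h := by
  rintro d ⟨θ, hθ, hP⟩
  rw [Fintype.sum_prod_type, Fin.sum_univ_succ]
  simp only [hzero, zero_mul, Finset.sum_const_zero, zero_add]
  refine Finset.sum_nonneg fun τ _ => ?_
  have hδsum : ∑ x, δ (τ.succ, x) = 1 := by
    rw [Fintype.sum_prod_type]
    exact hδ.1.2.1 τ
  have hPsum : ∑ x, (δ (τ.succ, x) + θ * d (τ.succ, x)) = 1 := by
    rw [Fintype.sum_prod_type]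
    exact hP.2.1 τ
  refine sum_mul_nonneg_of_sum_eq_zero (c := fun x => C (τ.succ, x))
    (d := fun x => d (τ.succ, x)) (i₀ := (sτ τ, rτ τ)) (fun x => hmin τ x.1 x.2) ?_ ?_
  · intro x hx
    have hδx : δ (τ.succ, x) = 0 :=
      eq_zero_of_sum_eq_one (p := fun y => δ (τ.succ, y)) (fun y => (hδ.1.1 _).1) hδsum
        (hone τ) hx
    have hPx : 0 ≤ δ (τ.succ, x) + θ * d (τ.succ, x) := (hP.1 _).1
    rw [hδx, zero_add] at hPx
    exact nonneg_of_mul_nonneg_right hPx hθ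
  · rw [Finset.sum_add_distrib, hδsum, ← Finset.mul_sum] at hPsum
    have hmul : θ * ∑ x, d (τ.succ, x) = 0 := by linarith
    exact (mul_eq_zero.mp hmul).resolve_left hθ.ne'
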